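/- arXiv:2305.18868 — 3 statements merged into one kernel-verified Lean document; each statement's English description precedes it below -/
import Mathlib

section
/- Let V be a finite-dimensional vector space over a field K, let A : V → V be a unipotent linear automorphism (i.e. A − id is nilpotent), let B : V → V → K be a nonzero bilinear form, and let c ∈ K be such that B(A x, A y) = c · B(x, y) for all x, y ∈ V. Then c = 1. -/
/-- If `A = N + id` scales a bilinear form by a factor other than `1`, then the form vanishes
on pairs of vectors killed by powers of `N`. -/
theorem bilin_eq_zero_of_pow_apply_eq_zero {K V : Type*} [Field K] [AddCommGroup V] [Module K V]
    {A : V →ₗ[K] V} {B : V →ₗ[K] V →ₗ[K] K} {c : K} (hc : c ≠ 1)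
    (hconf : ∀ x y : V, B (A x) (A y) = c * B x y) (a b : ℕ) (x y : V)
    (hx : ((A - LinearMap.id : Module.End K V) ^ a) x = 0)
    (hy : ((A - LinearMap.id : Module.End K V) ^ b) y = 0) :
    B x y = 0 := by
  induction a generalizing b x y with
  | zero => simp_all
  | succ a iha =>
    induction b generalizing y with
    | zero => simp_all
    | succ b ihb =>
      have hx' := hx
      have hy' := hy
      rw [pow_succ, Module.End.mul_apply] at hx' hy'
      have h₁ := iha (b + 1) _ y hx' hy
      have h₂ := ihb _ hy'
      have h₃ := iha b _ _ hx' hy'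
      have h₄ := hconf x y
      simp only [LinearMap.sub_apply, LinearMap.id_apply, map_sub] at h₁ h₂ h₃
      have h : (c - 1) * B x y = 0 := by linear_combination h₁ + h₂ + h₃ - h₄
      exact (mul_eq_zero.mp h).resolve_left (sub_ne_zero.mpr hc)

/-- A unipotent linear automorphism preserving the conformal class of a nonzero bilinear
form preserves the form itself: the conformal factor is `1`. -/
theorem unipotent_conformal_factor_eq_one
    (K : Type*) [Field K]
    (V : Type*) [AddCommGroup V] [Module K V] [FiniteDimensional K V]
    (A : V →ₗ[K] V) (hA : IsNilpotent (A - LinearMap.id))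
    (B : V →ₗ[K] V →ₗ[K] K) (hB : B ≠ 0)
    (c : K) (hconf : ∀ x y : V, B (A x) (A y) = c * B x y) :
    c = 1 := by
  by_contra hc
  obtain ⟨n, hn⟩ := hA
  refine hB (LinearMap.ext₂ fun x y => ?_)
  exact bilin_eq_zero_of_pow_apply_eq_zero hc hconf n n x y (by simp [hn]) (by simp [hn])
end

section
/- Let K be a field of characteristic zero, let V be a finite-dimensional vector space over K, and let H, E, F be linear endomorphisms of V satisfying the sl(2) commutation relations H∘E − E∘H = 2 E, H∘F − F∘H = −2 F, and E∘F − F∘E = H. Then the range of F is contained in (range H) + (range E), i.e. for every x ∈ V there exist y, z ∈ V with F x = H y + E z. -/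
/-- In a finite-dimensional representation, a vector of weight zero killed by `e` is killed by
`f`. -/
lemma IsSl2Triple.lie_f_eq_zero_of_lie_h_eq_zero {K L M : Type*} [Field K] [CharZero K]
    [LieRing L] [LieAlgebra K L] [AddCommGroup M] [Module K M] [LieRingModule L M]
    [LieModule K L M] [FiniteDimensional K M] {h e f : L} (t : IsSl2Triple h e f) {m : M}
    (hh : ⁅h, m⁆ = 0) (he : ⁅e, m⁆ = 0) : ⁅f, m⁆ = 0 := by
  by_cases hm : m = 0
  · simp [hm]
  have P : t.HasPrimitiveVectorWith m (0 : K) := ⟨hm, by simpa using hh, he⟩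
  simpa using P.pow_toEnd_f_eq_zero_of_eq_nat (n := 0) (by simp)

/-- For an `sl(2)`-triple `(H, E, F)` of endomorphisms of a finite-dimensional vector
space over a field of characteristic zero, the range of `F` is contained in
`range H + range E`. -/
theorem sl2_range_F_le_range_H_sup_range_E
    (K : Type*) [Field K] [CharZero K]
    (V : Type*) [AddCommGroup V] [Module K V] [FiniteDimensional K V]
    (H E F : V →ₗ[K] V)
    (hHE : H ∘ₗ E - E ∘ₗ H = (2 : K) • E)
    (hHF : H ∘ₗ F - F ∘ₗ H = -((2 : K) • F))
    (hEF : E ∘ₗ F - F ∘ₗ E = H) :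
    ∀ x : V, ∃ y z : V, F x = H y + E z := by
  intro x
  by_cases hH : H = 0
  · have hF : F = 0 := by simpa [hH] using hHF.symm
    exact ⟨0, 0, by simp [hF]⟩
  let _ : LieRing (Module.End K V) := LieRing.ofAssociativeRing
  have t : IsSl2Triple (L := Module.End K V) H E F :=
    ⟨hH, hEF, hHE.trans (by simp [two_smul]), hHF.trans (by simp [two_smul])⟩
  suffices hx : F x ∈ LinearMap.range H ⊔ LinearMap.range E by
    obtain ⟨_, ⟨y, rfl⟩, _, ⟨z, rfl⟩, hyz⟩ := Submodule.mem_sup.mp hx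
    exact ⟨y, z, hyz.symm⟩
  rw [← Subspace.forall_mem_dualAnnihilator_apply_eq_zero_iff]
  intro φ hφ
  rw [Submodule.mem_dualAnnihilator] at hφ
  have hφH : ⁅(H : Module.End K V), φ⁆ = 0 := by
    ext v
    simpa [Module.Dual.lie_apply] using hφ (H v) (Submodule.mem_sup_left ⟨v, rfl⟩)
  have hφE : ⁅(E : Module.End K V), φ⁆ = 0 := by
    ext v
    simpa [Module.Dual.lie_apply] using hφ (E v) (Submodule.mem_sup_right ⟨v, rfl⟩)
  have hφF := t.lie_f_eq_zero_of_lie_h_eq_zero (K := K) hφH hφE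
  simpa [Module.Dual.lie_apply] using LinearMap.congr_fun hφF x
end

section
/- Let V be a finite-dimensional real inner product space and let x, X₂, …, X_k ∈ V be linearly independent vectors. Then the family of endomorphisms of V consisting of X_i ∧ x for 2 ≤ i ≤ k together with the commutators ⁅X_i ∧ x, X_j ∧ x⁆ for 2 ≤ i < j ≤ k is linearly independent in the space of linear endomorphisms of V. -/
open RealInnerProductSpace

/-- The endomorphism `u ∧ w : y ↦ ⟨u, y⟩ w − ⟨w, y⟩ u` of a real inner product space. -/
noncomputable def wedgeMap (V : Type*) [NormedAddCommGroup V] [InnerProductSpace ℝ V]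
    (u w : V) : Module.End ℝ V :=
  (innerₛₗ ℝ u).smulRight w - (innerₛₗ ℝ w).smulRight u

theorem LinearIndependent.exists_inner_eq_ite {ι V : Type*} [DecidableEq ι]
    [NormedAddCommGroup V] [InnerProductSpace ℝ V] [FiniteDimensional ℝ V] {v : ι → V}
    (hv : LinearIndependent ℝ v) :
    ∃ ξ : ι → V, ∀ i j, ⟪v i, ξ j⟫ = if i = j then 1 else 0 := by
  obtain ⟨g, hg⟩ := LinearMap.exists_leftInverse_of_injective _
    (LinearMap.ker_eq_bot.mpr hv.finsuppLinearCombination_injective)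
  refine ⟨fun j => (InnerProductSpace.toDual ℝ V).symm
    (LinearMap.toContinuousLinearMap (Finsupp.lapply j ∘ₗ g)), fun i j => ?_⟩
  have h : g (v i) = Finsupp.single i 1 := by
    simpa using LinearMap.congr_fun hg (Finsupp.single i 1)
  rw [real_inner_comm, InnerProductSpace.toDual_symm_apply]
  simp [h, Finsupp.single_apply]

theorem inner_wedgeMap {V : Type*} [NormedAddCommGroup V] [InnerProductSpace ℝ V]
    (u w y z : V) :
    ⟪wedgeMap V u w y, z⟫ = ⟪u, y⟫ * ⟪w, z⟫ - ⟪w, y⟫ * ⟪u, z⟫ := by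
  simp [wedgeMap, inner_sub_left, real_inner_smul_left]

theorem lie_wedgeMap {V : Type*} [NormedAddCommGroup V] [InnerProductSpace ℝ V] (a b x : V) :
    ⁅wedgeMap V a x, wedgeMap V b x⁆ =
      ⟪x, x⟫ • wedgeMap V a b - ⟪x, b⟫ • wedgeMap V a x + ⟪x, a⟫ • wedgeMap V b x := by
  ext y
  simp only [wedgeMap, Ring.lie_def, Module.End.mul_apply, LinearMap.sub_apply,
    LinearMap.add_apply, LinearMap.smul_apply, LinearMap.smulRight_apply, innerₛₗ_apply_apply,
    inner_sub_right, real_inner_smul_right]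
  rw [real_inner_comm a x, real_inner_comm b x, real_inner_comm a b]
  module

/-- If `x, X₂, …, X_k` are linearly independent, then the endomorphisms `X_i ∧ x`
together with the commutators `⁅X_i ∧ x, X_j ∧ x⁆` for `i < j` are linearly
independent. -/
theorem linearIndependent_wedges_and_commutators
    (V : Type*) [NormedAddCommGroup V] [InnerProductSpace ℝ V] [FiniteDimensional ℝ V]
    (k : ℕ) (x : V) (X : Fin k → V)
    (hindep : LinearIndependent ℝ (Fin.cons x X : Fin (k + 1) → V)) :
    LinearIndependent ℝ
      (Sum.elim (fun i : Fin k => wedgeMap V (X i) x)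
        (fun p : {p : Fin k × Fin k // p.1 < p.2} =>
          ⁅wedgeMap V (X p.1.1) x, wedgeMap V (X p.1.2) x⁆)) := by
  obtain ⟨ξ, hξ⟩ := hindep.exists_inner_eq_ite
  have hxs (j : Fin k) : ⟪x, ξ j.succ⟫ = 0 := by
    simpa [(Fin.succ_ne_zero j).symm] using hξ 0 j.succ
  have hx0 : ⟪x, ξ 0⟫ = 1 := by simpa using hξ 0 0
  have hXs (i j : Fin k) : ⟪X i, ξ j.succ⟫ = if i = j then 1 else 0 := by
    simpa using hξ i.succ j.succ
  have hX0 (i : Fin k) : ⟪X i, ξ 0⟫ = 0 := by simpa using hξ i.succ 0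
  have hx : x ≠ 0 := by simpa using hindep.ne_zero 0
  rw [Fintype.linearIndependent_iff]
  intro c hc
  have pair (y z : V) := congrArg (fun A : Module.End ℝ V => ⟪A y, z⟫) hc
  simp only [Fintype.sum_sum_type, Sum.elim_inl, Sum.elim_inr, lie_wedgeMap,
    LinearMap.add_apply, LinearMap.sub_apply, LinearMap.sum_apply, LinearMap.smul_apply,
    LinearMap.zero_apply, inner_add_left, inner_sub_left, sum_inner, real_inner_smul_left,
    inner_wedgeMap, inner_zero_left] at pair
  have hcomm (p : {p : Fin k × Fin k // p.1 < p.2}) : c (Sum.inr p) = 0 := by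
    have h := pair (ξ p.1.1.succ) (ξ p.1.2.succ)
    simp only [hxs, hXs, mul_zero, zero_mul, sub_zero, add_zero, zero_add,
      Finset.sum_const_zero] at h
    rw [Finset.sum_eq_single p] at h
    · simpa [p.2.ne, p.2.ne', hx] using h
    · rintro ⟨⟨a, b⟩, hab⟩ - hne
      obtain ⟨⟨i, j⟩, hij⟩ := p
      simp only [ne_eq, Subtype.mk.injEq, Prod.mk.injEq] at hne hab hij ⊢
      grind
    · simp
  rintro (i | p)
  · simpa [hcomm, hxs, hXs, hx0, hX0] using pair (ξ i.succ) (ξ 0)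
  · exact hcomm p
end
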